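/- arXiv:2511.11657 — 2 statements merged into one kernel-verified Lean document; each statement's English description precedes it below -/
import Mathlib

section
/- Exact floor formula for the n-th lucky number: let n ≥ 2 and let β = L(n). Define m₀ = n and m_{j+1} = ⌊(m_j·l_{β−j} − 1)/(l_{β−j} − 1)⌋ for 0 ≤ j ≤ β − 1. Then m_β = l_n. (For example, for n = 8 this gives ⌊(8·7−1)/6⌋ = 9, ⌊(9·3−1)/2⌋ = 13, ⌊(13·2−1)/1⌋ = 25 = l₈.) -/
open scoped BigOperators

namespace LuckyPaper

/-- Rank of `k` in `A`: the number of elements of `A` that are `≤ k`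
(the 1-indexed position of `k` in `A` when `k ∈ A`). -/
noncomputable def rank (A : Set ℕ) (k : ℕ) : ℕ := Set.ncard {m | m ∈ A ∧ m ≤ k}

/-- One sieve step: delete every `d`-th element of `A` (listed in increasing order). -/
noncomputable def step (A : Set ℕ) (d : ℕ) : Set ℕ := {k | k ∈ A ∧ ¬ d ∣ rank A k}

/-- The lucky sieve: `sieve i = (A_i, l_i)`, where `A_0 = {1,2,3,…}`, `l_0 = 1` (dummy),
`l_{i+1}` is the smallest element of `A_i` larger than `l_i`, and `A_{i+1}` is obtained
from `A_i` by deleting every `l_{i+1}`-th element.  In particular `l_1 = 2`. -/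
noncomputable def sieve : ℕ → Set ℕ × ℕ
  | 0 => ({n | 1 ≤ n}, 1)
  | i + 1 =>
      let p := sieve i
      let d := sInf {m | m ∈ p.1 ∧ p.2 < m}
      (step p.1 d, d)

/-- `A i` : the set of survivors after `i` steps of the lucky sieve. -/
noncomputable def A (i : ℕ) : Set ℕ := (sieve i).1

/-- `l i` : the `i`-th sieve parameter (`l 1 = 2`, `l 2 = 3`, `l 3 = 7`, `l 4 = 9`, …);
with this convention `l n` is the `n`-th lucky number for `n ≥ 2`. -/
noncomputable def l (i : ℕ) : ℕ := (sieve i).2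

/-- The set of lucky numbers `A_∞ = ⋂ i, A i = {1, 3, 7, 9, 13, 15, 21, 25, …}`. -/
noncomputable def LuckySet : Set ℕ := ⋂ i, A i

/-- `L x` : the number of lucky numbers that are `≤ x`. -/
noncomputable def L (x : ℝ) : ℕ := Set.ncard {m | m ∈ LuckySet ∧ (m : ℝ) ≤ x}

/-- `R i x = #{k ∈ A_{i-1} : k ≤ x}`. -/
noncomputable def R (i : ℕ) (x : ℝ) : ℕ := Set.ncard {m | m ∈ A (i - 1) ∧ (m : ℝ) ≤ x}

/-- `𝕃 = {l 1, l 2, l 3, …} = {2, 3, 7, 9, 13, …}`. -/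
noncomputable def Ell : Set ℕ := {a | ∃ i, 1 ≤ i ∧ l i = a}

/-- `starIdx i m` : the `m`-th number deleted at step `i` of the sieve, i.e. the
`(l i * m)`-th smallest element of `A (i-1)` (`Nat.nth` is 0-indexed). -/
noncomputable def starIdx (i m : ℕ) : ℕ := Nat.nth (· ∈ A (i - 1)) (l i * m - 1)

/-- The binary operation `*` : for `a ∈ 𝕃`, `star a m = a * m` is the `m`-th number
deleted at the (unique) step `i ≥ 1` with `l i = a`. -/
noncomputable def star (a m : ℕ) : ℕ := starIdx (sInf {i | 1 ≤ i ∧ l i = a}) m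

/-- `evalStar [a₁, …, a_k] = a₁ * (a₂ * (⋯ * a_k)⋯)`. -/
noncomputable def evalStar : List ℕ → ℕ
  | [] => 1
  | [a] => a
  | a :: b :: rest => star a (evalStar (b :: rest))

/-- `t = (a₁, …, a_k)` is a lucky factorization of `n` : `k ≥ 1`, `a_j ∈ 𝕃` for `j < k`,
`a_k` is a lucky number (possibly 1), and `n = a₁*(a₂*(⋯*a_k)⋯)`. -/
def IsLuckyFactorization (n : ℕ) (t : List ℕ) : Prop :=
  t ≠ [] ∧ (∀ a ∈ t.dropLast, a ∈ Ell) ∧ t.getLast! ∈ LuckySet ∧ evalStar t = n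

/-- The canonical tuple of `n` given by the fundamental theorem of arithmetic
for lucky numbers. -/
noncomputable def canonicalTuple (n : ℕ) : List ℕ :=
  haveI := Classical.propDecidable (∃ t, IsLuckyFactorization n t)
  if h : ∃ t, IsLuckyFactorization n t then h.choose else []

/-- `Ω°(n)` : the length of the canonical tuple of `n`. -/
noncomputable def bigOmega (n : ℕ) : ℕ := (canonicalTuple n).length

/-- `ω°(n)` : the number of distinct entries of the canonical tuple of `n`. -/
noncomputable def smallOmega (n : ℕ) : ℕ := (canonicalTuple n).dedup.length

/-- `d°(n)` : the number of distinct nonempty contiguous subtuples (infixes) of the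
canonical tuple of `n`. -/
noncomputable def dCirc (n : ℕ) : ℕ :=
  Set.ncard {s : List ℕ | s ≠ [] ∧ s <:+: canonicalTuple n}

/-- `B` : positive integers whose canonical tuple has last entry `≠ 1`. -/
noncomputable def Bset : Set ℕ := {n | 1 ≤ n ∧ (canonicalTuple n).getLast! ≠ 1}

/-- `C` : positive integers whose canonical tuple ends with the pair `(2, 1)`. -/
noncomputable def Cset : Set ℕ := {n | 1 ≤ n ∧ ∃ t, canonicalTuple n = t ++ [2, 1]}

/-- `S = B ∪ C`. -/
noncomputable def Sset : Set ℕ := Bset ∪ Cset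

/-- The `𝕃`-tuple of `a ∈ S` : the canonical tuple of `a` if it does not end in `1`,
else the canonical tuple with the final `1` removed (so it ends in `2`). -/
noncomputable def ellTuple (a : ℕ) : List ℕ :=
  if (canonicalTuple a).getLast! = 1 then (canonicalTuple a).dropLast else canonicalTuple a

/-- The extended operation `∘` : if the `𝕃`-tuple of `a` is `(t₁, …, t_k)`, then
`a ∘ b = t₁*(t₂*(⋯*(t_k*b)⋯))`. -/
noncomputable def circ (a b : ℕ) : ℕ := (ellTuple a).foldr star b


theorem rank_succ (A : Set ℕ) (k : ℕ) [Decidable (k + 1 ∈ A)] :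
    rank A (k + 1) = rank A k + if k + 1 ∈ A then 1 else 0 := by
  have hfin : {m | m ∈ A ∧ m ≤ k}.Finite := (Set.finite_Iic k).subset fun m hm => hm.2
  unfold rank
  split_ifs with h
  · rw [← Set.ncard_insert_of_notMem (a := k + 1) (by simp) hfin]
    congr 1
    ext m
    simp only [Set.mem_ofPred_eq, Set.mem_insert_iff]
    grind
  · congr 1
    ext m
    simp only [Set.mem_ofPred_eq]
    grind

theorem rank_eq_zero {A : Set ℕ} (h0 : 0 ∉ A) : rank A 0 = 0 := by
  have : {m | m ∈ A ∧ m ≤ 0} = ∅ := by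
    ext m
    simp only [Set.mem_ofPred_eq, Set.mem_empty_iff_false, iff_false]
    grind
  rw [rank, this, Set.ncard_empty]

theorem rank_mono (A : Set ℕ) : Monotone (rank A) := by
  classical
  exact monotone_nat_of_le_succ fun k => by rw [rank_succ]; omega

/-- The rank does not change along a gap of `A`. -/
theorem rank_eq_of_gap {A : Set ℕ} {a b : ℕ} (hab : a ≤ b)
    (hgap : ∀ k, a < k → k ≤ b → k ∉ A) : rank A b = rank A a := by
  classical
  induction b, hab using Nat.le_induction with
  | base => rfl
  | succ b hab ih =>
    rw [rank_succ, if_neg (hgap _ (by omega) le_rfl), add_zero,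
      ih fun k hk hkb => hgap k hk (by omega)]

theorem rank_next {A : Set ℕ} {a b : ℕ} (hab : a < b) (hb : b ∈ A)
    (hgap : ∀ k, a < k → k < b → k ∉ A) : rank A b = rank A a + 1 := by
  classical
  obtain ⟨c, rfl⟩ : ∃ c, b = c + 1 := ⟨b - 1, by omega⟩
  rw [rank_succ, if_pos hb,
    rank_eq_of_gap (a := a) (by omega) fun k hk hkc => hgap k hk (by omega)]

theorem rank_step {A : Set ℕ} (h0 : 0 ∉ A) (d k : ℕ) :
    rank (step A d) k = rank A k - rank A k / d := by
  classical
  induction k with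
  | zero =>
    have : 0 ∉ step A d := fun h => h0 h.1
    simp [rank_eq_zero h0, rank_eq_zero this]
  | succ k ih =>
    have hle : rank A k / d ≤ rank A k := Nat.div_le_self _ _
    have hmem : k + 1 ∈ step A d ↔ k + 1 ∈ A ∧ ¬ d ∣ rank A (k + 1) := Iff.rfl
    rw [rank_succ (step A d), ih]
    by_cases hk : k + 1 ∈ A
    · have hr : rank A (k + 1) = rank A k + 1 := by rw [rank_succ, if_pos hk]
      by_cases hd : d ∣ rank A k + 1
      · rw [if_neg (by rw [hmem, hr]; tauto), hr, Nat.succ_div_of_dvd hd]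
        omega
      · rw [if_pos (by rw [hmem, hr]; tauto), hr, Nat.succ_div_of_not_dvd hd]
        omega
    · have hr : rank A (k + 1) = rank A k := by rw [rank_succ, if_neg hk, add_zero]
      rw [if_neg (by rw [hmem]; tauto), hr, add_zero]

/-- The rank of a survivor before a sieve step, in terms of its rank afterwards. -/
theorem rank_eq_rank_step_add_div {A : Set ℕ} (h0 : 0 ∉ A) {d k : ℕ} (hd : 2 ≤ d)
    (hk : k ∈ step A d) :
    rank A k = rank (step A d) k + (rank (step A d) k - 1) / (d - 1) := by
  have hnd : ¬ d ∣ rank A k := hk.2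
  rw [rank_step h0]
  generalize rank A k = r at hnd ⊢
  obtain ⟨e, rfl⟩ : ∃ e, d = e + 1 := ⟨d - 1, by omega⟩
  have hr := Nat.div_add_mod r (e + 1)
  have hs := Nat.mod_lt r (show 0 < e + 1 by omega)
  have hpos : r % (e + 1) ≠ 0 := fun h => hnd (Nat.dvd_of_mod_eq_zero h)
  generalize r / (e + 1) = q at *
  generalize r % (e + 1) = s at *
  have hsub : r - q = e * q + s := by
    have : (e + 1) * q = e * q + q := by ring
    omega
  have hdiv : (r - q - 1) / (e + 1 - 1) = q := by
    rw [hsub, Nat.add_sub_cancel, Nat.add_sub_assoc (by omega),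
      Nat.mul_add_div (by omega), Nat.div_eq_of_lt (by omega), add_zero]
  have : (e + 1) * q = e * q + q := by ring
  rw [hdiv]
  omega

theorem floor_mul_sub_one_div {a d : ℕ} (ha : 1 ≤ a) (hd : 2 ≤ d) :
    ⌊((a : ℝ) * d - 1) / ((d : ℝ) - 1)⌋ = ((a + (a - 1) / (d - 1) : ℕ) : ℤ) := by
  obtain ⟨e, rfl⟩ : ∃ e, d = e + 1 := ⟨d - 1, by omega⟩
  obtain ⟨b, rfl⟩ : ∃ b, a = b + 1 := ⟨a - 1, by omega⟩
  have he : (e : ℝ) ≠ 0 := by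
    have : e ≠ 0 := by omega
    exact_mod_cast this
  have h : (((b + 1 : ℕ) : ℝ) * ((e + 1 : ℕ) : ℝ) - 1) / (((e + 1 : ℕ) : ℝ) - 1)
      = (b : ℝ) / (e : ℝ) + ((b + 1 : ℕ) : ℝ) := by
    push_cast
    rw [add_sub_cancel_right]
    field_simp
    ring
  rw [h, Int.floor_add_natCast, ← Int.natCast_floor_eq_floor (by positivity),
    Nat.floor_div_eq_div]
  simp only [Nat.add_sub_cancel]
  push_cast
  ring

theorem A_succ (i : ℕ) : A (i + 1) = step (A i) (l (i + 1)) := rfl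

theorem mem_A_zero {k : ℕ} : k ∈ A 0 ↔ 1 ≤ k := Iff.rfl

theorem A_antitone : Antitone A := antitone_nat_of_succ_le fun _ _ hk => hk.1

theorem zero_notMem_A (i : ℕ) : 0 ∉ A i := fun h =>
  absurd (mem_A_zero.1 (A_antitone (Nat.zero_le i) h)) (by omega)

theorem rank_A_zero (k : ℕ) : rank (A 0) k = k := by
  classical
  induction k with
  | zero => exact rank_eq_zero (zero_notMem_A 0)
  | succ k ih => rw [rank_succ, if_pos (mem_A_zero.2 (by omega)), ih]

theorem rank_A_succ (i k : ℕ) :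
    rank (A (i + 1)) k = rank (A i) k - rank (A i) k / l (i + 1) :=
  rank_step (zero_notMem_A i) _ _

theorem exists_lt_of_rank_unbounded {A : Set ℕ} (h : ∀ N, ∃ k, N ≤ rank A k) (a : ℕ) :
    {m | m ∈ A ∧ a < m}.Nonempty := by
  by_contra hne
  obtain ⟨k, hk⟩ := h (rank A a + 1)
  have hgap : ∀ b, a < b → b ∉ A := fun b hb hbA => hne ⟨b, hbA, hb⟩
  rcases le_total k a with hka | hak
  · have := rank_mono A hka
    omega
  · rw [rank_eq_of_gap hak fun b hb _ => hgap b hb] at hk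
    omega

theorem rank_A_unbounded_and_lt_l (i : ℕ) :
    (∀ N, ∃ k, N ≤ rank (A i) k) ∧ i + 1 ≤ l i := by
  induction i with
  | zero => exact ⟨fun N => ⟨N, (rank_A_zero N).ge⟩, le_rfl⟩
  | succ i ih =>
    have hl : l i < l (i + 1) := (Nat.sInf_mem (exists_lt_of_rank_unbounded ih.1 (l i))).2
    refine ⟨fun N => ?_, by omega⟩
    obtain ⟨k, hk⟩ := ih.1 (2 * N)
    refine ⟨k, ?_⟩
    have := Nat.div_le_div_left (a := rank (A i) k) (show 2 ≤ l (i + 1) by omega) two_pos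
    rw [rank_A_succ]
    omega

theorem lt_l (i : ℕ) : i < l i := (rank_A_unbounded_and_lt_l i).2

theorem l_succ_mem (i : ℕ) : l (i + 1) ∈ A i ∧ l i < l (i + 1) :=
  Nat.sInf_mem (exists_lt_of_rank_unbounded (rank_A_unbounded_and_lt_l i).1 (l i))

theorem l_strictMono : StrictMono l := strictMono_nat_of_lt_succ fun i => (l_succ_mem i).2

theorem l_succ_le {i k : ℕ} (hk : k ∈ A i) (hlt : l i < k) : l (i + 1) ≤ k :=
  Nat.sInf_le ⟨hk, hlt⟩

/-- An element whose rank is below the next sieve parameter survives with the same rank. -/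
theorem mem_A_and_rank_eq_of_le {i j k : ℕ} (hk : k ∈ A i) (hr : rank (A i) k < l (i + 1))
    (hij : i ≤ j) : k ∈ A j ∧ rank (A j) k = rank (A i) k := by
  classical
  induction j, hij using Nat.le_induction with
  | base => exact ⟨hk, rfl⟩
  | succ j hij ih =>
    obtain ⟨hkj, hrj⟩ := ih
    have hle : l (i + 1) ≤ l (j + 1) := l_strictMono.monotone (by omega)
    have hlt : rank (A j) k < l (j + 1) := by omega
    have hpos : 0 < rank (A j) k := by
      obtain ⟨c, rfl⟩ : ∃ c, k = c + 1 :=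
        Nat.exists_eq_succ_of_ne_zero fun h => zero_notMem_A j (h ▸ hkj)
      rw [rank_succ, if_pos hkj]
      omega
    refine ⟨⟨hkj, fun hdvd => ?_⟩, ?_⟩
    · have : l (j + 1) ≤ rank (A j) k := Nat.le_of_dvd hpos hdvd
      omega
    · rw [rank_A_succ, Nat.div_eq_of_lt hlt, hrj, Nat.sub_zero]

theorem l_one : l 1 = 2 :=
  le_antisymm (l_succ_le (i := 0) (mem_A_zero.2 (by omega)) (by exact Nat.one_lt_two))
    (lt_l 1)

theorem l_two : l 2 = 3 := by
  refine le_antisymm (l_succ_le (i := 1) ⟨mem_A_zero.2 (by omega), ?_⟩ ?_) (lt_l 2)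
  · change ¬ l 1 ∣ rank (A 0) 3
    rw [l_one, rank_A_zero]
    decide
  · rw [l_one]
    omega

theorem rank_A_l_succ {i : ℕ} (hi : 1 ≤ i) : rank (A i) (l (i + 1)) = i + 1 := by
  induction i, hi using Nat.le_induction with
  | base => rw [rank_A_succ, rank_A_zero, zero_add, l_one, l_two]
  | succ i hi ih =>
    obtain ⟨-, hr⟩ := mem_A_and_rank_eq_of_le (l_succ_mem i).1 (ih.trans_lt (lt_l (i + 1)))
      (Nat.le_succ i)
    obtain ⟨hmem, hlt⟩ := l_succ_mem (i + 1)
    rw [rank_next hlt hmem fun k hk hkl hkA => absurd (l_succ_le hkA hk) (by omega), hr, ih]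

theorem l_mem_A_and_rank {n : ℕ} (hn : 2 ≤ n) {j : ℕ} (hj : n ≤ j + 1) :
    l n ∈ A j ∧ rank (A j) (l n) = n := by
  obtain ⟨i, rfl⟩ : ∃ i, n = i + 1 := ⟨n - 1, by omega⟩
  have hr := rank_A_l_succ (i := i) (by omega)
  have := mem_A_and_rank_eq_of_le (l_succ_mem i).1 (hr.trans_lt (lt_l (i + 1)))
    (show i ≤ j by omega)
  rwa [hr] at this

theorem mem_luckySet_of_rank_lt {i k : ℕ} (hk : k ∈ A i) (hr : rank (A i) k < l (i + 1)) :
    k ∈ LuckySet :=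
  Set.mem_iInter.2 fun j => (le_total i j).elim
    (fun hij => (mem_A_and_rank_eq_of_le hk hr hij).1) fun hji => A_antitone hji hk

theorem l_mem_A {n : ℕ} (hn : 2 ≤ n) (j : ℕ) : l n ∈ A j :=
  A_antitone (le_max_left j n) (l_mem_A_and_rank hn (by omega)).1

theorem finite_lucky_le (n : ℕ) : {m | m ∈ LuckySet ∧ (m : ℝ) ≤ n}.Finite :=
  (Set.finite_Iic n).subset fun _ hm => Nat.cast_le.1 hm.2

theorem one_le_L {n : ℕ} (hn : 1 ≤ n) : 1 ≤ L n := by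
  refine (Set.ncard_pos (finite_lucky_le n)).2 ⟨1, ?_, by exact_mod_cast hn⟩
  exact mem_luckySet_of_rank_lt (i := 0) (mem_A_zero.2 le_rfl)
    (by rw [rank_A_zero]; exact lt_l 1)

theorem lt_l_L_succ {n : ℕ} (hn : 1 ≤ n) : n < l (L n + 1) := by
  by_contra! hle
  obtain ⟨β, hβ⟩ : ∃ β, β = L n := ⟨_, rfl⟩
  rw [← hβ] at hle
  have hr := rank_A_l_succ (hβ ▸ one_le_L hn : 1 ≤ β)
  have hsub : {m | m ∈ A β ∧ m ≤ l (β + 1)} ⊆ {m | m ∈ LuckySet ∧ (m : ℝ) ≤ n} := by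
    rintro k ⟨hk, hkl⟩
    refine ⟨mem_luckySet_of_rank_lt hk ?_, by exact_mod_cast hkl.trans hle⟩
    exact ((rank_mono _ hkl).trans_eq hr).trans_lt (lt_l (β + 1))
  have : rank (A β) (l (β + 1)) ≤ L n := Set.ncard_le_ncard hsub (finite_lucky_le n)
  omega

theorem rank_A_l_eq {n : ℕ} (hn : 2 ≤ n) {j : ℕ} (hj : n < l (j + 1)) :
    rank (A j) (l n) = n := by
  suffices h : ∀ d, rank (A (j + d)) (l n) = n → rank (A j) (l n) = n from
    h n (l_mem_A_and_rank hn (by omega)).2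
  intro d
  induction d with
  | zero => exact id
  | succ d ih =>
    refine fun h => ih ?_
    have hlt : n < l (j + d + 1) := hj.trans_le (l_strictMono.monotone (by omega))
    rw [rank_eq_rank_step_add_div (zero_notMem_A _) (d := l (j + d + 1)) (by omega)
      (l_mem_A hn (j + d + 1)), ← A_succ, show j + d + 1 = j + (d + 1) by omega, h,
      Nat.div_eq_of_lt (by rw [← add_assoc]; omega), add_zero]

/-- exact floor formula for the `n`-th lucky number: let `n ≥ 2`,
`β = L(n)`, `m₀ = n` and `m_{j+1} = ⌊(m_j·l_{β−j} − 1)/(l_{β−j} − 1)⌋` for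
`0 ≤ j ≤ β − 1`.  Then `m_β = l_n`. -/
theorem nth_lucky_floor_formula (n : ℕ) (hn : 2 ≤ n) (β : ℕ) (hβ : β = L (n : ℝ))
    (m : ℕ → ℕ) (hm0 : m 0 = n)
    (hrec : ∀ j, j < β →
      (m (j + 1) : ℤ) =
        ⌊((m j : ℝ) * (l (β - j) : ℝ) - 1) / ((l (β - j) : ℝ) - 1)⌋) :
    m β = l n := by
  have hn1 : 1 ≤ n := by omega
  have key : ∀ j, j ≤ β → m j = rank (A (β - j)) (l n) := by
    intro j
    induction j with
    | zero =>
      intro _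
      rw [hm0, Nat.sub_zero, rank_A_l_eq hn (hβ ▸ lt_l_L_succ hn1)]
    | succ j ih =>
      intro hj
      obtain ⟨i, hi⟩ : ∃ i, β - j = i + 1 := ⟨β - j - 1, by omega⟩
      have hd : 2 ≤ l (i + 1) := by have := lt_l (i + 1); omega
      have hmj := ih (by omega)
      have hrank := rank_eq_rank_step_add_div (zero_notMem_A i) hd (l_mem_A hn (i + 1))
      rw [hi] at hmj
      have hpos : 1 ≤ m j := by
        by_contra! h0
        have hz : rank (step (A i) (l (i + 1))) (l n) = 0 := by
          rw [← A_succ, ← hmj]; omega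
        rw [hz] at hrank
        simp only [zero_tsub, Nat.zero_div, add_zero] at hrank
        exact (l_mem_A hn (i + 1)).2 (hrank ▸ dvd_zero _)
      have h := hrec j (by omega)
      rw [hi, floor_mul_sub_one_div hpos hd, Nat.cast_inj] at h
      rw [h, show β - (j + 1) = i by omega, hrank, ← A_succ, hmj]
  rw [key β le_rfl, Nat.sub_self, rank_A_zero]

end LuckyPaper
end

section
/- Exact formula for l_i * m: for every i ≥ 1 and m ≥ 1, define u₀ = l_i·m and u_{j+1} = ⌈u_j·l_{i−1−j}/(l_{i−1−j} − 1) − 1⌉ for 0 ≤ j ≤ i − 2. Then u_{i−1} = l_i * m (for i = 1 this reads 2 * m = 2m). -/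
open scoped BigOperators

namespace LuckyPaper

/-- The `k`-th natural number (0-indexed) such that its successor is not a multiple of `d`. -/
def skipIndex (d k : ℕ) : ℕ := k + k / (d - 1)

theorem skipIndex_strictMono (d : ℕ) : StrictMono (skipIndex d) := fun _ _ h =>
  add_lt_add_of_lt_of_le h (Nat.div_le_div_right h.le)

theorem mem_range_skipIndex {d : ℕ} (hd : 2 ≤ d) (q : ℕ) :
    q ∈ Set.range (skipIndex d) ↔ ¬ d ∣ q + 1 := by
  obtain ⟨e, rfl⟩ : ∃ e, d = e + 1 := ⟨d - 1, by omega⟩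
  simp only [skipIndex, Set.mem_range, Nat.add_sub_cancel]
  constructor
  · rintro ⟨k, rfl⟩
    have hlt := Nat.mod_lt k (show 0 < e by omega)
    have hq : k + k / e + 1 = (k % e + 1) + (e + 1) * (k / e) := by
      linear_combination -(Nat.mod_add_div k e)
    rw [hq, ← Nat.dvd_add_iff_left (Dvd.intro _ rfl)]
    exact Nat.not_dvd_of_pos_of_lt (by omega) (by omega)
  · intro h
    have hq := Nat.mod_add_div q (e + 1)
    have hlt : q % (e + 1) < e := by
      have := Nat.mod_lt q (show 0 < e + 1 by omega)
      refine lt_of_le_of_ne (by omega) fun he => h ⟨q / (e + 1) + 1, ?_⟩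
      linear_combination he - hq
    refine ⟨q % (e + 1) + e * (q / (e + 1)), ?_⟩
    rw [Nat.add_mul_div_left _ _ (show 0 < e by omega), Nat.div_eq_of_lt hlt]
    linear_combination hq

theorem skipIndex_succ_eq_ceil {d : ℕ} (hd : 2 ≤ d) (k : ℕ) :
    ((skipIndex d k + 1 : ℕ) : ℤ) = ⌈((k + 1 : ℕ) : ℝ) * (d : ℝ) / ((d : ℝ) - 1) - 1⌉ := by
  obtain ⟨e, rfl⟩ : ∃ e, d = e + 1 := ⟨d - 1, by omega⟩
  have he : (0 : ℝ) < e := by exact_mod_cast (show 0 < e by omega)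
  simp only [skipIndex, Nat.add_sub_cancel]
  have hmod := Nat.mod_add_div k e
  have hlt := Nat.mod_lt k (show 0 < e by omega)
  have hlow : (e : ℝ) * (k / e : ℕ) < k + 1 := by
    exact_mod_cast (show e * (k / e) < k + 1 by omega)
  have hupp : (k : ℝ) + 1 ≤ e * (k / e : ℕ) + e := by
    exact_mod_cast (show k + 1 ≤ e * (k / e) + e by omega)
  have hval : ((k + 1 : ℕ) : ℝ) * ((e + 1 : ℕ) : ℝ) / (((e + 1 : ℕ) : ℝ) - 1) - 1
      = k + (k + 1) / e := by
    push_cast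
    rw [add_sub_cancel_right]
    field_simp
    ring
  rw [hval, eq_comm, Int.ceil_eq_iff]
  have h₁ : ((k / e : ℕ) : ℝ) < (k + 1) / e := by rw [lt_div_iff₀ he]; linarith
  have h₂ : ((k : ℝ) + 1) / e ≤ (k / e : ℕ) + 1 := by rw [div_le_iff₀ he]; linarith
  generalize k / e = q at h₁ h₂ ⊢
  push_cast
  constructor <;> linarith

theorem rank_nth {S : Set ℕ} (hS : S.Infinite) (q : ℕ) : rank S (Nat.nth (· ∈ S) q) = q + 1 := by
  classical
  rw [← Nat.count_nth_succ_of_infinite (p := (· ∈ S)) hS q, Nat.count_eq_card_filter_range, rank,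
    ← Set.ncard_coe_finset]
  congr 1
  ext x
  simp [and_comm]

theorem range_nth_comp_skipIndex {S : Set ℕ} (hS : S.Infinite) {d : ℕ} (hd : 2 ≤ d) :
    Set.range (fun k => Nat.nth (· ∈ S) (skipIndex d k)) = step S d := by
  ext x
  constructor
  · rintro ⟨k, rfl⟩
    exact ⟨Nat.nth_mem_of_infinite hS _, by
      rw [rank_nth hS, ← mem_range_skipIndex hd]; exact ⟨k, rfl⟩⟩
  · rintro ⟨hx, hdvd⟩
    obtain ⟨q, rfl⟩ : x ∈ Set.range (Nat.nth (· ∈ S)) := by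
      rw [Nat.range_nth_of_infinite (p := (· ∈ S)) hS]; exact hx
    rw [rank_nth hS, ← mem_range_skipIndex hd] at hdvd
    obtain ⟨k, rfl⟩ := hdvd
    exact ⟨k, rfl⟩

theorem strictMono_nth_comp_skipIndex {S : Set ℕ} (hS : S.Infinite) (d : ℕ) :
    StrictMono (fun k => Nat.nth (· ∈ S) (skipIndex d k)) :=
  (Nat.nth_strictMono hS).comp (skipIndex_strictMono d)

theorem step_infinite {S : Set ℕ} (hS : S.Infinite) {d : ℕ} (hd : 2 ≤ d) :
    (step S d).Infinite := by
  rw [← range_nth_comp_skipIndex hS hd]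
  exact Set.infinite_range_of_injective (strictMono_nth_comp_skipIndex hS d).injective

theorem nth_step {S : Set ℕ} (hS : S.Infinite) {d : ℕ} (hd : 2 ≤ d) (k : ℕ) :
    Nat.nth (· ∈ step S d) k = Nat.nth (· ∈ S) (skipIndex d k) := by
  have hinf := step_infinite hS hd
  refine congrFun (((Nat.nth_strictMono hinf).range_inj
    (strictMono_nth_comp_skipIndex hS d)).1 ?_) k
  rw [range_nth_comp_skipIndex hS hd, Nat.range_nth_of_infinite hinf]
  rfl

theorem l_lt_l_succ {i : ℕ} (h : (A i).Infinite) : l i < l (i + 1) := by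
  obtain ⟨b, hb, hlt⟩ := h.exists_gt (l i)
  exact (Nat.sInf_mem (s := {m | m ∈ A i ∧ l i < m}) ⟨b, hb, hlt⟩).2

theorem A_infinite_and_l_pos (i : ℕ) : (A i).Infinite ∧ 1 ≤ l i := by
  induction i with
  | zero => exact ⟨Set.Ici_infinite 1, le_rfl⟩
  | succ i ih =>
    have hlt := l_lt_l_succ ih.1
    exact ⟨step_infinite ih.1 (d := l (i + 1)) (by omega), by omega⟩

theorem A_infinite (i : ℕ) : (A i).Infinite := (A_infinite_and_l_pos i).1

theorem two_le_l_succ (i : ℕ) : 2 ≤ l (i + 1) :=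
  (Nat.succ_le_succ (A_infinite_and_l_pos i).2).trans (l_lt_l_succ (A_infinite i))

theorem nth_A_succ (i k : ℕ) :
    Nat.nth (· ∈ A (i + 1)) k = Nat.nth (· ∈ A i) (skipIndex (l (i + 1)) k) :=
  nth_step (A_infinite i) (two_le_l_succ i) k

theorem nth_A_zero (k : ℕ) : Nat.nth (· ∈ A 0) k = k + 1 := by
  refine congrFun (((Nat.nth_strictMono (A_infinite 0)).range_inj
    (fun _ _ h => Nat.succ_lt_succ h)).1 ?_) k
  rw [Nat.range_nth_of_infinite (A_infinite 0)]
  ext x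
  change 1 ≤ x ↔ ∃ y, y + 1 = x
  exact ⟨fun h => ⟨x - 1, by omega⟩, by rintro ⟨y, rfl⟩; omega⟩

/-- exact formula for `l_i * m`: for every `i ≥ 1` and `m ≥ 1`, define
`u₀ = l_i·m` and `u_{j+1} = ⌈u_j·l_{i−1−j}/(l_{i−1−j} − 1) − 1⌉` for `0 ≤ j ≤ i − 2`.
Then `u_{i−1} = l_i * m` (for `i = 1` this reads `2 * m = 2m`). -/
theorem star_ceiling_formula (i : ℕ) (hi : 1 ≤ i) (m : ℕ) (hm : 1 ≤ m) (u : ℕ → ℕ)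
    (hu0 : u 0 = l i * m)
    (hrec : ∀ j, j + 2 ≤ i →
      (u (j + 1) : ℤ) =
        ⌈(u j : ℝ) * (l (i - 1 - j) : ℝ) / ((l (i - 1 - j) : ℝ) - 1) - 1⌉) :
    u (i - 1) = starIdx i m := by
  have key : ∀ j, j + 1 ≤ i →
      1 ≤ u j ∧ Nat.nth (· ∈ A (i - 1 - j)) (u j - 1) = starIdx i m := by
    intro j
    induction j with
    | zero =>
      intro _
      obtain ⟨-, hl⟩ := A_infinite_and_l_pos i
      exact ⟨hu0 ▸ Nat.mul_pos hl hm, by rw [hu0]; rfl⟩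
    | succ j ih =>
      intro hj
      obtain ⟨hpos, hnth⟩ := ih (by omega)
      obtain ⟨k, hk⟩ : ∃ k, u j = k + 1 := ⟨u j - 1, by omega⟩
      have hidx : i - 1 - j = (i - 1 - (j + 1)) + 1 := by omega
      have hu := hrec j (by omega)
      rw [hidx, hk, ← skipIndex_succ_eq_ceil (two_le_l_succ _), Nat.cast_inj] at hu
      rw [hidx, hk, Nat.add_sub_cancel, nth_A_succ] at hnth
      exact ⟨by omega, by rw [hu, Nat.add_sub_cancel, hnth]⟩
  obtain ⟨hpos, hnth⟩ := key (i - 1) (by omega)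
  rwa [Nat.sub_self, nth_A_zero, Nat.sub_add_cancel hpos] at hnth

end LuckyPaper
end
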